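/- (Exact second-order expansion of the LQR cost.) Let K ∈ S and let ΔK be an m×n real matrix such that K + ΔK ∈ S. Then f(K + ΔK) − f(K) = 2 Tr( Y(K+ΔK) (ΔK)ᵀ M(K) ) + Tr( Y(K+ΔK) (ΔK)ᵀ ( R + Bᵀ X(K) B ) (ΔK) ). -/

import Mathlib

open Matrix

/-- `M` is Schur stable: spectral radius `ρ(M) < 1`. -/
def IsSchur {k : ℕ} (M : Matrix (Fin k) (Fin k) ℝ) : Prop :=
  ∀ μ ∈ spectrum ℂ (M.map (Complex.ofReal ·)), ‖μ‖ < 1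

open Filter Topology in
theorem tendsto_pow_zero_of_spectralRadius_lt_one {E : Type*} [NormedRing E]
    [NormedAlgebra ℂ E] [CompleteSpace E] {a : E} (ha : spectralRadius ℂ a < 1) :
    Tendsto (fun k : ℕ => a ^ k) atTop (𝓝 0) := by
  obtain ⟨r, hr, hr1⟩ := exists_between ha
  have h := spectrum.pow_nnnorm_pow_one_div_tendsto_nhds_spectralRadius a
  have hev : ∀ᶠ k : ℕ in atTop, ((‖a ^ k‖₊ : ENNReal)) ≤ r ^ k := by
    filter_upwards [h.eventually_lt_const hr, eventually_gt_atTop 0] with k hk hk0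
    have := pow_le_pow_left₀ (zero_le) hk.le k
    rwa [← ENNReal.rpow_natCast, ← ENNReal.rpow_mul, one_div_mul_cancel (by positivity),
      ENNReal.rpow_one] at this
  have h0 : Tendsto (fun k : ℕ => (‖a ^ k‖₊ : ENNReal)) atTop (𝓝 0) :=
    tendsto_of_tendsto_of_tendsto_of_le_of_le' tendsto_const_nhds
      (ENNReal.tendsto_pow_atTop_nhds_zero_of_lt_one hr1)
      (Eventually.of_forall fun _ => zero_le) hev
  have h1 : Tendsto (fun k : ℕ => ‖a ^ k‖₊) atTop (𝓝 0) := by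
    rw [← ENNReal.tendsto_coe]
    simpa using h0
  rw [tendsto_zero_iff_norm_tendsto_zero]
  simpa only [coe_nnnorm, NNReal.coe_zero] using NNReal.tendsto_coe.mpr h1

attribute [local instance] Matrix.linftyOpNormedRing Matrix.linftyOpNormedAlgebra in
open Filter Topology in
theorem IsSchur.tendsto_pow {k : ℕ} {F : Matrix (Fin k) (Fin k) ℝ} (hF : IsSchur F) :
    Tendsto (fun j : ℕ => F ^ j) atTop (𝓝 0) := by
  rcases Nat.eq_zero_or_pos k with rfl | hk
  · exact tendsto_const_nhds.congr fun _ => Subsingleton.elim _ _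
  have : NeZero k := ⟨hk.ne'⟩
  have hs : spectralRadius ℂ (F.map (Complex.ofReal ·)) < ((1 : NNReal) : ENNReal) :=
    spectrum.spectralRadius_lt_of_forall_lt _ fun z hz => hF z hz
  have h := tendsto_pow_zero_of_spectralRadius_lt_one (by simpa using hs)
  have hpow (j : ℕ) : (F.map (Complex.ofReal ·)) ^ j = (F ^ j).map (Complex.ofReal ·) :=
    (map_pow (Complex.ofRealHom.mapMatrix (m := Fin k)) F j).symm
  have hre : Continuous fun M : Matrix (Fin k) (Fin k) ℂ => M.map Complex.re :=
    continuous_id.matrix_map Complex.continuous_re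
  have h' := (hre.tendsto 0).comp h
  have e : (0 : Matrix (Fin k) (Fin k) ℂ).map Complex.re = 0 := by ext; simp
  rw [e] at h'
  refine h'.congr fun j => ?_
  ext a b
  simp [hpow]

/-- The homogeneous Stein equation of a Schur stable matrix has only the zero solution. -/
theorem IsSchur.eq_zero_of_mul_mul_transpose_eq {k : ℕ} {F D : Matrix (Fin k) (Fin k) ℝ}
    (hF : IsSchur F) (hD : F * D * Fᵀ = D) : D = 0 := by
  have hj (j : ℕ) : F ^ j * D * (F ^ j)ᵀ = D := by
    induction j with
    | zero => simp
    | succ j ih =>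
      calc F ^ (j + 1) * D * (F ^ (j + 1))ᵀ = F ^ j * (F * D * Fᵀ) * (F ^ j)ᵀ := by
            simp only [pow_succ, transpose_mul, Matrix.mul_assoc]
        _ = D := by rw [hD, ih]
  have hc : Continuous fun M : Matrix (Fin k) (Fin k) ℝ => M * D * Mᵀ := by fun_prop
  have h := (hc.tendsto 0).comp hF.tendsto_pow
  simp only [Function.comp_def, hj, Matrix.zero_mul] at h
  exact tendsto_nhds_unique tendsto_const_nhds h

/-- The homogeneous dual Stein equation of a Schur stable matrix has only the zero solution. -/
theorem IsSchur.eq_zero_of_transpose_mul_mul_eq {k : ℕ} {F D : Matrix (Fin k) (Fin k) ℝ}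
    (hF : IsSchur F) (hD : Fᵀ * D * F = D) : D = 0 := by
  have hj (j : ℕ) : (F ^ j)ᵀ * D * F ^ j = D := by
    induction j with
    | zero => simp
    | succ j ih =>
      calc (F ^ (j + 1))ᵀ * D * F ^ (j + 1) = (F ^ j)ᵀ * (Fᵀ * D * F) * F ^ j := by
            rw [pow_succ']
            simp only [transpose_mul, Matrix.mul_assoc]
        _ = D := by rw [hD, ih]
  have hc : Continuous fun M : Matrix (Fin k) (Fin k) ℝ => Mᵀ * D * M := by fun_prop
  have h := (hc.tendsto 0).comp hF.tendsto_pow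
  simp only [Function.comp_def, hj, Matrix.mul_zero] at h
  exact tendsto_nhds_unique tendsto_const_nhds h

/-- The solution of a Stein equation with symmetric constant term is symmetric. -/
theorem IsSchur.transpose_eq_of_mul_mul_transpose_add_eq {k : ℕ}
    {F S Y : Matrix (Fin k) (Fin k) ℝ} (hF : IsSchur F) (hS : Sᵀ = S)
    (hY : F * Y * Fᵀ + S = Y) : Yᵀ = Y := by
  have hYt : F * Yᵀ * Fᵀ + S = Yᵀ := by
    have := congrArg transpose hY
    simpa only [transpose_add, transpose_mul, transpose_transpose, hS, Matrix.mul_assoc] using this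
  refine sub_eq_zero.mp (hF.eq_zero_of_mul_mul_transpose_eq ?_)
  rw [Matrix.mul_sub, Matrix.sub_mul, eq_sub_of_add_eq hYt, eq_sub_of_add_eq hY]
  abel

/-- The solution of a dual Stein equation with symmetric constant term is symmetric. -/
theorem IsSchur.transpose_eq_of_transpose_mul_mul_add_eq {k : ℕ}
    {F S X : Matrix (Fin k) (Fin k) ℝ} (hF : IsSchur F) (hS : Sᵀ = S)
    (hX : Fᵀ * X * F + S = X) : Xᵀ = X := by
  have hXt : Fᵀ * Xᵀ * F + S = Xᵀ := by
    have := congrArg transpose hX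
    simpa only [transpose_add, transpose_mul, transpose_transpose, hS, Matrix.mul_assoc] using this
  refine sub_eq_zero.mp (hF.eq_zero_of_transpose_mul_mul_eq ?_)
  rw [Matrix.mul_sub, Matrix.sub_mul, eq_sub_of_add_eq hXt, eq_sub_of_add_eq hX]
  abel

/-- Pairing with the constant term of a Stein equation moves the Stein operator to the adjoint. -/
theorem trace_mul_eq_of_mul_mul_transpose_add_eq {k : ℕ} {F S Y : Matrix (Fin k) (Fin k) ℝ}
    (hY : F * Y * Fᵀ + S = Y) (Z : Matrix (Fin k) (Fin k) ℝ) :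
    trace (Z * S) = trace (Y * (Z - Fᵀ * Z * F)) := by
  have h : trace (Z * (F * Y * Fᵀ)) = trace (Y * (Fᵀ * Z * F)) := by
    rw [show Z * (F * Y * Fᵀ) = (Z * F) * (Y * Fᵀ) by simp only [Matrix.mul_assoc],
      trace_mul_comm]
    simp only [Matrix.mul_assoc]
  rw [eq_sub_of_add_eq' hY, Matrix.mul_sub, Matrix.mul_sub, trace_sub, trace_sub, h,
    trace_mul_comm Z]

theorem stmt17 {n m : ℕ} (hn : 0 < n) (hm : 0 < m)
    (A : Matrix (Fin n) (Fin n) ℝ) (B : Matrix (Fin n) (Fin m) ℝ)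
    (Q Sig : Matrix (Fin n) (Fin n) ℝ) (R : Matrix (Fin m) (Fin m) ℝ)
    (hQ : Q.PosDef) (hR : R.PosDef) (hSig : Sig.PosDef)
    (X : Matrix (Fin m) (Fin n) ℝ → Matrix (Fin n) (Fin n) ℝ)
    (Y : Matrix (Fin m) (Fin n) ℝ → Matrix (Fin n) (Fin n) ℝ)
    (hX : ∀ K, IsSchur (A - B * K) →
      (A - B * K)ᵀ * X K * (A - B * K) + Kᵀ * R * K + Q = X K)
    (hY : ∀ K, IsSchur (A - B * K) →
      (A - B * K) * Y K * (A - B * K)ᵀ + Sig = Y K)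
    (K ΔK : Matrix (Fin m) (Fin n) ℝ)
    (hK : IsSchur (A - B * K)) (hK' : IsSchur (A - B * (K + ΔK))) :
    Matrix.trace (X (K + ΔK) * Sig) - Matrix.trace (X K * Sig)
      = 2 * Matrix.trace (Y (K + ΔK) * ΔKᵀ * (R * K - Bᵀ * X K * (A - B * K)))
        + Matrix.trace (Y (K + ΔK) * ΔKᵀ * (R + Bᵀ * X K * B) * ΔK) := by
  have hRt : Rᵀ = R := by simpa [conjTranspose_eq_transpose_of_trivial] using hR.isHermitian.eq
  have hQt : Qᵀ = Q := by simpa [conjTranspose_eq_transpose_of_trivial] using hQ.isHermitian.eq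
  have hSt : Sigᵀ = Sig := by
    simpa [conjTranspose_eq_transpose_of_trivial] using hSig.isHermitian.eq
  have hXe := hX K hK
  have hXe' := hX _ hK'
  have hYe := hY _ hK'
  have hYt := hK'.transpose_eq_of_mul_mul_transpose_add_eq hSt hYe
  have hXt : (X K)ᵀ = X K :=
    hK.transpose_eq_of_transpose_mul_mul_add_eq (S := Kᵀ * R * K + Q)
      (by simp only [transpose_add, transpose_mul, transpose_transpose, hRt, hQt,
        Matrix.mul_assoc]) (by rw [← add_assoc]; exact hXe)
  rw [trace_mul_eq_of_mul_mul_transpose_add_eq hYe, trace_mul_eq_of_mul_mul_transpose_add_eq hYe,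
    ← trace_sub, ← Matrix.mul_sub]
  generalize Y (K + ΔK) = V at *
  generalize X (K + ΔK) = W at *
  generalize X K = P at *
  set N := ΔKᵀ * (R * K - Bᵀ * P * (A - B * K)) with hN
  have hNt : Nᵀ = (Kᵀ * R - (A - B * K)ᵀ * P * B) * ΔK := by
    rw [hN]
    simp only [transpose_sub, transpose_mul, transpose_transpose, hRt, hXt, Matrix.mul_assoc]
  have htr : trace (V * Nᵀ) = trace (V * N) := by
    rw [← trace_transpose, transpose_mul, transpose_transpose, hYt, trace_mul_comm]
  have hF : A - B * (K + ΔK) = (A - B * K) - B * ΔK := by rw [Matrix.mul_add]; abel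
  have key : W - (A - B * (K + ΔK))ᵀ * W * (A - B * (K + ΔK))
      - (P - (A - B * (K + ΔK))ᵀ * P * (A - B * (K + ΔK)))
      = N + Nᵀ + ΔKᵀ * (R + Bᵀ * P * B) * ΔK := by
    have h1 : W - (A - B * (K + ΔK))ᵀ * W * (A - B * (K + ΔK)) =
        (K + ΔK)ᵀ * R * (K + ΔK) + Q := by
      rw [sub_eq_iff_eq_add, add_comm, ← add_assoc]; exact hXe'.symm
    have h2 : Q = P - Kᵀ * R * K - (A - B * K)ᵀ * P * (A - B * K) := by
      nth_rewrite 1 [← hXe]; abel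
    rw [h1, h2, hNt, hN, hF]
    generalize A - B * K = F
    simp only [transpose_sub, transpose_add, transpose_mul, Matrix.mul_sub, Matrix.sub_mul,
      Matrix.mul_add, Matrix.add_mul, Matrix.mul_assoc]
    abel
  rw [key, Matrix.mul_add, Matrix.mul_add, trace_add, trace_add, htr, two_mul]
  simp only [hN, Matrix.mul_assoc]
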